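/- With ν(v) as in the collision frequency of the relativistic Boltzmann equation (ν(v) = 4π ∫_{ℝ³} (g√(4+g²)/(u₀v₀)) e^{-√(1+|u|²)} du), there exists C > 0 such that |∂_{v_j} ν(v)| ≤ C/√(1+|v|²) for all v ∈ ℝ³ and j = 1,2,3. -/

import Mathlib

open MeasureTheory Real
open scoped RealInnerProductSpace

noncomputable def energy (v : EuclideanSpace ℝ (Fin 3)) : ℝ := Real.sqrt (1 + ‖v‖ ^ 2)

noncomputable def relMom (u v : EuclideanSpace ℝ (Fin 3)) : ℝ :=
  Real.sqrt (2 * (energy u * energy v - ⟪u, v⟫ + 1) - 4)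

noncomputable def collFreq (v : EuclideanSpace ℝ (Fin 3)) : ℝ :=
  4 * π * ∫ u : EuclideanSpace ℝ (Fin 3),
    relMom u v * Real.sqrt (4 + relMom u v ^ 2) / (energy u * energy v) *
      Real.exp (-Real.sqrt (1 + ‖u‖ ^ 2))

lemma energy_sq (v : EuclideanSpace ℝ (Fin 3)) : energy v ^ 2 = 1 + ‖v‖ ^ 2 :=
  Real.sq_sqrt (by positivity)

lemma one_le_energy (v : EuclideanSpace ℝ (Fin 3)) : 1 ≤ energy v :=
  Real.one_le_sqrt.2 (by nlinarith [sq_nonneg ‖v‖])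

lemma norm_le_energy (v : EuclideanSpace ℝ (Fin 3)) : ‖v‖ ≤ energy v :=
  Real.le_sqrt_of_sq_le (by linarith)

lemma continuous_energy : Continuous energy := by
  unfold energy; fun_prop

lemma abs_energy_sub_le (v w : EuclideanSpace ℝ (Fin 3)) : |energy v - energy w| ≤ ‖v - w‖ := by
  have hv := one_le_energy v
  have hw := one_le_energy w
  have h : |energy v - energy w| * (energy v + energy w) ≤ ‖v - w‖ * (energy v + energy w) := by
    calc |energy v - energy w| * (energy v + energy w)
        = |(energy v - energy w) * (energy v + energy w)| := by
          rw [abs_mul, abs_of_pos (by linarith : 0 < energy v + energy w)]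
      _ = |(‖v‖ - ‖w‖) * (‖v‖ + ‖w‖)| := by
          congr 1; linear_combination energy_sq v - energy_sq w
      _ = |‖v‖ - ‖w‖| * (‖v‖ + ‖w‖) := by
          rw [abs_mul, abs_of_nonneg (by positivity : 0 ≤ ‖v‖ + ‖w‖)]
      _ ≤ ‖v - w‖ * (energy v + energy w) :=
          mul_le_mul (abs_norm_sub_norm_le v w)
            (add_le_add (norm_le_energy v) (norm_le_energy w)) (by positivity) (by positivity)
  exact le_of_mul_le_mul_right h (by linarith)

/-- The spatial part of the momentum `v` seen in the rest frame of the momentum `u`. -/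
noncomputable def boost (u v : EuclideanSpace ℝ (Fin 3)) : EuclideanSpace ℝ (Fin 3) :=
  v + (⟪u, v⟫ / (1 + energy u) - energy v) • u

lemma norm_boost_sq (u v : EuclideanSpace ℝ (Fin 3)) :
    ‖boost u v‖ ^ 2 = (energy u * energy v - ⟪u, v⟫) ^ 2 - 1 := by
  have ha : 1 + energy u ≠ 0 := by linarith [one_le_energy u]
  have hu : ‖u‖ ^ 2 = energy u ^ 2 - 1 := by linarith [energy_sq u]
  have hv : ‖v‖ ^ 2 = energy v ^ 2 - 1 := by linarith [energy_sq v]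
  rw [boost, norm_add_sq_real, norm_smul, mul_pow, inner_smul_right, real_inner_comm, hu, hv,
    Real.norm_eq_abs, sq_abs]
  field_simp
  ring

lemma abs_inner_div_le (u v : EuclideanSpace ℝ (Fin 3)) : |⟪u, v⟫ / (1 + energy u)| ≤ ‖v‖ := by
  have hu := one_le_energy u
  rw [abs_div, abs_of_pos (by linarith : 0 < 1 + energy u), div_le_iff₀ (by linarith)]
  nlinarith [abs_real_inner_le_norm u v, norm_le_energy u, norm_nonneg v]

lemma norm_boost_sub_le (u v w : EuclideanSpace ℝ (Fin 3)) :
    ‖boost u v - boost u w‖ ≤ 3 * energy u * ‖v - w‖ := by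
  have h : boost u v - boost u w
      = (v - w) + (⟪u, v - w⟫ / (1 + energy u) - (energy v - energy w)) • u := by
    rw [boost, boost, inner_sub_right]
    module
  have hc : |⟪u, v - w⟫ / (1 + energy u) - (energy v - energy w)| ≤ 2 * ‖v - w‖ :=
    (abs_sub _ _).trans (by linarith [abs_inner_div_le u (v - w), abs_energy_sub_le v w])
  have hm := mul_le_mul hc (norm_le_energy u) (norm_nonneg u) (by positivity)
  rw [h]
  refine (norm_add_le _ _).trans ?_
  rw [norm_smul, Real.norm_eq_abs]
  nlinarith [one_le_energy u, norm_nonneg (v - w)]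

lemma norm_boost_le (u v : EuclideanSpace ℝ (Fin 3)) : ‖boost u v‖ ≤ 3 * energy u * energy v := by
  have hv := one_le_energy v
  have hc : |⟪u, v⟫ / (1 + energy u) - energy v| ≤ 2 * energy v := by
    refine (abs_sub _ _).trans ?_
    rw [abs_of_pos (by linarith : 0 < energy v)]
    linarith [abs_inner_div_le u v, norm_le_energy v]
  have hm := mul_le_mul hc (norm_le_energy u) (norm_nonneg u) (by positivity)
  refine (norm_add_le _ _).trans ?_
  rw [norm_smul, Real.norm_eq_abs]
  nlinarith [one_le_energy u, norm_le_energy v]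

lemma relMom_mul_sqrt (u v : EuclideanSpace ℝ (Fin 3)) :
    relMom u v * √(4 + relMom u v ^ 2) = 2 * ‖boost u v‖ := by
  have hb := norm_boost_sq u v
  have h_nonneg : 0 ≤ energy u * energy v - ⟪u, v⟫ := by
    have := mul_le_mul (norm_le_energy u) (norm_le_energy v) (norm_nonneg v)
      (by linarith [one_le_energy u])
    linarith [real_inner_le_norm u v]
  have h_one : 1 ≤ energy u * energy v - ⟪u, v⟫ := by
    nlinarith [sq_nonneg ‖boost u v‖]
  have h_rad : 0 ≤ 2 * (energy u * energy v - ⟪u, v⟫ + 1) - 4 := by linarith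
  rw [relMom, Real.sq_sqrt h_rad, ← Real.sqrt_mul h_rad,
    Real.sqrt_eq_iff_mul_self_eq (mul_nonneg h_rad (by linarith)) (by positivity)]
  linear_combination -4 * hb

lemma integrable_exp_neg_energy : Integrable fun u : EuclideanSpace ℝ (Fin 3) ↦ Real.exp (-energy u) := by
  have h := (integrable_rpow_neg_one_add_norm_sq (E := EuclideanSpace ℝ (Fin 3)) (μ := volume) (r := 4)
    (by simp; norm_num)).const_mul 24
  refine h.mono' (by have := continuous_energy; fun_prop) (.of_forall fun u ↦ ?_)
  have hu := one_le_energy u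
  have he := Real.pow_div_factorial_le_exp (energy u) (by linarith) 4
  have hp : (1 + ‖u‖ ^ 2) ^ (-(4 : ℝ) / 2) = (energy u ^ 4)⁻¹ := by
    rw [← energy_sq, show (-(4 : ℝ) / 2) = -((2 : ℕ) : ℝ) by norm_num,
      Real.rpow_neg (by positivity), Real.rpow_natCast, ← pow_mul]
  rw [Real.norm_eq_abs, Real.abs_exp, Real.exp_neg, hp, ← div_eq_mul_inv,
    inv_le_comm₀ (Real.exp_pos _) (by positivity), inv_div]
  simpa [Nat.factorial] using he

/-- The integrand of the collision frequency, up to the factor `2`. -/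
noncomputable def collKernel (u v : EuclideanSpace ℝ (Fin 3)) : ℝ :=
  ‖boost u v‖ / (energy u * energy v) * Real.exp (-energy u)

lemma collFreq_eq (v : EuclideanSpace ℝ (Fin 3)) : collFreq v = 8 * π * ∫ u, collKernel u v := by
  have h : ∀ u, relMom u v * √(4 + relMom u v ^ 2) / (energy u * energy v) *
      Real.exp (-√(1 + ‖u‖ ^ 2)) = 2 * collKernel u v := fun u ↦ by
    rw [relMom_mul_sqrt, collKernel, energy]; ring
  simp_rw [collFreq, h, integral_const_mul]
  ring

lemma integrable_collKernel (v : EuclideanSpace ℝ (Fin 3)) : Integrable fun u ↦ collKernel u v := by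
  have hE := continuous_energy
  have h_ne : ∀ u : EuclideanSpace ℝ (Fin 3), energy u ≠ 0 := fun u ↦ by linarith [one_le_energy u]
  have h_ne' : ∀ u : EuclideanSpace ℝ (Fin 3), 1 + energy u ≠ 0 := fun u ↦ by linarith [one_le_energy u]
  have hcont : Continuous fun u ↦ collKernel u v := by
    unfold collKernel boost
    fun_prop (disch := simp [h_ne])
  refine (integrable_exp_neg_energy.const_mul 3).mono' hcont.aestronglyMeasurable
    (.of_forall fun u ↦ ?_)
  have hu := one_le_energy u
  have hv := one_le_energy v
  rw [Real.norm_eq_abs, collKernel, abs_of_nonneg (by positivity)]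
  gcongr
  rw [div_le_iff₀ (by positivity), ← mul_assoc]
  exact norm_boost_le u v

lemma abs_collKernel_sub_le (u v w : EuclideanSpace ℝ (Fin 3)) :
    |collKernel w u - collKernel w v| ≤ 6 * ‖u - v‖ / energy v * Real.exp (-energy w) := by
  have hu := one_le_energy u
  have hv := one_le_energy v
  have hw := one_le_energy w
  have h_eq : ‖boost w u‖ / (energy w * energy u) - ‖boost w v‖ / (energy w * energy v)
      = ((‖boost w u‖ - ‖boost w v‖) / energy w
          + ‖boost w u‖ / (energy w * energy u) * (energy v - energy u)) / energy v := by
    field_simp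
    ring
  have h_fst : |(‖boost w u‖ - ‖boost w v‖) / energy w| ≤ 3 * ‖u - v‖ := by
    rw [abs_div, abs_of_pos (by linarith : 0 < energy w), div_le_iff₀ (by linarith)]
    linarith [abs_norm_sub_norm_le (boost w u) (boost w v), norm_boost_sub_le w u v]
  have h_snd : |‖boost w u‖ / (energy w * energy u) * (energy v - energy u)| ≤ 3 * ‖u - v‖ := by
    rw [abs_mul, abs_of_nonneg (by positivity)]
    gcongr
    · rw [div_le_iff₀ (by positivity), ← mul_assoc]
      exact norm_boost_le w u
    · rw [norm_sub_rev]
      exact abs_energy_sub_le v u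
  rw [collKernel, collKernel, ← sub_mul, abs_mul, Real.abs_exp, h_eq, abs_div,
    abs_of_pos (by linarith : 0 < energy v)]
  gcongr
  exact (abs_add_le _ _).trans (by linarith)

lemma abs_collFreq_sub_le (u v : EuclideanSpace ℝ (Fin 3)) :
    |collFreq u - collFreq v|
      ≤ 48 * π * (∫ w : EuclideanSpace ℝ (Fin 3), Real.exp (-energy w)) / energy v * ‖u - v‖ := by
  rw [collFreq_eq, collFreq_eq, ← mul_sub,
    ← integral_sub (integrable_collKernel u) (integrable_collKernel v), abs_mul,
    abs_of_pos (by positivity : 0 < 8 * π)]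
  have h := norm_integral_le_of_norm_le (f := fun w ↦ collKernel w u - collKernel w v)
    (integrable_exp_neg_energy.const_mul (6 * ‖u - v‖ / energy v))
    (.of_forall fun w ↦ abs_collKernel_sub_le u v w)
  rw [integral_const_mul, Real.norm_eq_abs] at h
  calc _ ≤ 8 * π * (6 * ‖u - v‖ / energy v * ∫ w : EuclideanSpace ℝ (Fin 3), Real.exp (-energy w)) := by gcongr
    _ = _ := by ring

/-- The partial derivatives of the collision frequency decay like `1/√(1+|v|²)`. -/
theorem collFreq_deriv_bound :
    ∃ C > 0, ∀ (v : EuclideanSpace ℝ (Fin 3)) (j : Fin 3),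
      |fderiv ℝ collFreq v (EuclideanSpace.single j (1 : ℝ))|
        ≤ C / Real.sqrt (1 + ‖v‖ ^ 2) := by
  have hI : 0 ≤ ∫ w : EuclideanSpace ℝ (Fin 3), Real.exp (-energy w) := integral_nonneg fun _ ↦ (Real.exp_pos _).le
  refine ⟨48 * π * (∫ w : EuclideanSpace ℝ (Fin 3), Real.exp (-energy w)) + 1, by positivity, fun v j ↦ ?_⟩
  have hv := one_le_energy v
  have h := norm_fderiv_le_of_lip' ℝ (f := collFreq) (x₀ := v)
    (by positivity : 0 ≤ 48 * π * (∫ w : EuclideanSpace ℝ (Fin 3), Real.exp (-energy w)) / energy v)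
    (.of_forall fun u ↦ abs_collFreq_sub_le u v)
  calc |fderiv ℝ collFreq v (EuclideanSpace.single j (1 : ℝ))|
      ≤ ‖fderiv ℝ collFreq v‖ * ‖EuclideanSpace.single j (1 : ℝ)‖ :=
        (fderiv ℝ collFreq v).le_opNorm _
    _ = ‖fderiv ℝ collFreq v‖ := by simp
    _ ≤ _ := h
    _ ≤ (48 * π * (∫ w : EuclideanSpace ℝ (Fin 3), Real.exp (-energy w)) + 1) / energy v := by
        gcongr
        linarith
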